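/- For every odd integer d ≥ 15, one has B_{3σ+4}(d) > B_{σ+γ}(d) > B_6(d); that is, the count of solutions a (0 < a < 2^d−1) of s(a) + s((k−1)a) = s(ka) + 1 for the Glynn type (II) exponent k = 3σ+4 strictly exceeds that for the Glynn type (I) exponent k = σ+γ, which strictly exceeds that for the Segre exponent k = 6. -/

import Mathlib

/-- `sBin d x` is the number of 1's in the binary representation of the reduction of `x`
modulo `2^d - 1`. -/
def sBin (d x : ℕ) : ℕ := (Nat.digits 2 (x % (2 ^ d - 1))).count 1

/-- `B k d` is the number of `a` with `0 < a < 2^d - 1` such that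
`s(a) + s((k-1)a) = s(ka) + 1`. -/
def B (k d : ℕ) : ℕ :=
  ((Finset.Ioo 0 (2 ^ d - 1)).filter
    (fun a => sBin d a + sBin d ((k - 1) * a) = sBin d (k * a) + 1)).card

/-- `γ = 2^{(3d+1)/4}` if `d ≡ 1 (mod 4)`, and `γ = 2^{(d+1)/4}` if `d ≡ 3 (mod 4)`. -/
def gam (d : ℕ) : ℕ := if d % 4 = 1 then 2 ^ ((3 * d + 1) / 4) else 2 ^ ((d + 1) / 4)
/-! ## Cyclic binary words -/

/-- numerical value of a cyclic word of integers -/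
def VV {d : ℕ} [NeZero d] (W : ZMod d → ℤ) : ℤ := ∑ i, W i * 2 ^ i.val

/-- the integer value of a bit -/
def bt (b : Bool) : ℤ := cond b 1 0

lemma bt_nonneg (b : Bool) : 0 ≤ bt b := by cases b <;> simp [bt]
lemma bt_le_one (b : Bool) : bt b ≤ 1 := by cases b <;> simp [bt]
lemma bt_inj {b c : Bool} (h : bt b = bt c) : b = c := by
  cases b <;> cases c <;> simp_all [bt]

lemma two_pow_val_succ {d : ℕ} [NeZero d] (i : ZMod d) :
    (2 : ℤ) ^ (i + 1).val = 2 * 2 ^ i.val - if i = -1 then (2 ^ d - 1 : ℤ) else 0 := by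
  obtain ⟨n, rfl⟩ : ∃ n, d = n + 1 := ⟨d - 1, by have := NeZero.ne d; omega⟩
  split_ifs with h
  · subst h
    have : (-1 : ZMod (n + 1)).val = n := ZMod.val_neg_one n
    rw [this]; simp [pow_succ]; ring
  · have h1 : i.val ≠ n := by
      intro h2
      apply h
      apply ZMod.val_injective
      rw [h2]; exact (ZMod.val_neg_one n).symm
    have h3 := ZMod.val_lt i
    have h4 : (i + 1).val = i.val + 1 := by
      rw [ZMod.val_add_of_lt]
      · rcases n with _ | n
        · omega
        · rw [ZMod.val_one'' (by omega)]
      · have := Nat.mod_le 1 (n + 1)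
        rw [ZMod.val_one_eq_one_mod]
        omega
    rw [h4]; ring

lemma VV_shift {d : ℕ} [NeZero d] (W : ZMod d → ℤ) :
    VV (fun i => W (i - 1)) = 2 * VV W - (2 ^ d - 1) * W (-1) := by
  unfold VV
  rw [← Equiv.sum_comp (Equiv.addRight (1 : ZMod d))]
  simp only [Equiv.coe_addRight, add_sub_cancel_right, two_pow_val_succ, mul_sub]
  rw [Finset.sum_sub_distrib, Finset.mul_sum]
  congr 1
  · apply Finset.sum_congr rfl; intros; ring
  · simp [mul_comm]

lemma VV_add {d : ℕ} [NeZero d] (W X : ZMod d → ℤ) :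
    VV (fun i => W i + X i) = VV W + VV X := by
  simp [VV, add_mul, Finset.sum_add_distrib]

lemma VV_sub {d : ℕ} [NeZero d] (W X : ZMod d → ℤ) :
    VV (fun i => W i - X i) = VV W - VV X := by
  simp [VV, sub_mul, Finset.sum_sub_distrib]

lemma VV_mul {d : ℕ} [NeZero d] (m : ℤ) (W : ZMod d → ℤ) :
    VV (fun i => m * W i) = m * VV W := by
  simp [VV, Finset.mul_sum, mul_assoc]

lemma VV_sum {d : ℕ} [NeZero d] (E : Finset ℕ) (W : ℕ → ZMod d → ℤ) :
    VV (fun i => ∑ e ∈ E, W e i) = ∑ e ∈ E, VV (W e) := by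
  simp only [VV, Finset.sum_mul]
  rw [Finset.sum_comm]

/-- multiplication by `2^m` is a cyclic shift, modulo `2^d-1` -/
lemma VV_shift_pow {d : ℕ} [NeZero d] (W : ZMod d → ℤ) (m : ℕ) :
    VV (fun i : ZMod d => W (i - (m : ZMod d))) ≡ 2 ^ m * VV W [ZMOD (2 ^ d - 1)] := by
  induction m generalizing W with
  | zero => simp
  | succ m ih =>
    have h1 : (fun i : ZMod d => W (i - ((m + 1 : ℕ) : ZMod d))) =
        fun i : ZMod d => (fun j : ZMod d => W (j - (m : ZMod d))) (i - 1) := by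
      funext i; congr 1; push_cast; ring
    rw [h1, VV_shift (fun j : ZMod d => W (j - (m : ZMod d)))]
    have h2 : 2 * VV (fun j : ZMod d => W (j - (m : ZMod d))) - (2 ^ d - 1) * (fun j : ZMod d => W (j - (m : ZMod d))) (-1) ≡
        2 * VV (fun j : ZMod d => W (j - (m : ZMod d))) [ZMOD (2 ^ d - 1)] := by
      apply Int.modEq_iff_dvd.2
      exact ⟨(fun j : ZMod d => W (j - (m : ZMod d))) (-1), by ring⟩
    refine h2.trans ?_
    have := (ih W).mul_left 2
    rw [pow_succ]
    calc _ ≡ _ [ZMOD (2 ^ d - 1)] := this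
      _ = _ := by ring

lemma VV_one {d : ℕ} [NeZero d] : VV (fun _ : ZMod d => (1 : ℤ)) = 2 ^ d - 1 := by
  have := VV_shift (fun _ : ZMod d => (1 : ℤ))
  linarith

lemma VV_mono {d : ℕ} [NeZero d] {W X : ZMod d → ℤ} (h : ∀ i, W i ≤ X i) : VV W ≤ VV X := by
  unfold VV
  apply Finset.sum_le_sum
  intro i _
  have := h i
  gcongr

lemma VV_nonneg {d : ℕ} [NeZero d] (a : ZMod d → Bool) : 0 ≤ VV (fun i => bt (a i)) := by
  unfold VV
  apply Finset.sum_nonneg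
  intro i _
  have := bt_nonneg (a i)
  positivity

lemma VV_le {d : ℕ} [NeZero d] (a : ZMod d → Bool) : VV (fun i => bt (a i)) ≤ 2 ^ d - 1 := by
  rw [← VV_one]; exact VV_mono fun i => bt_le_one _

lemma VV_lt {d : ℕ} [NeZero d] (a : ZMod d → Bool) (j : ZMod d) (hj : a j = false) :
    VV (fun i => bt (a i)) < 2 ^ d - 1 := by
  rw [← VV_one]
  unfold VV
  apply Finset.sum_lt_sum
  · intro i _
    have := bt_le_one (a i)
    gcongr
  · exact ⟨j, Finset.mem_univ _, by simp [hj, bt]⟩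

lemma exists_false_of_VV_lt {d : ℕ} [NeZero d] (a : ZMod d → Bool)
    (h : VV (fun i => bt (a i)) < 2 ^ d - 1) : ∃ j, a j = false := by
  by_contra! hc
  have : a = fun _ => true := by funext i; simpa using hc i
  subst this
  have h2 := VV_one (d := d)
  simp only [bt, cond_true] at h
  omega

/-- the carry lemma -/
lemma exists_carry {d : ℕ} [NeZero d] (W : ZMod d → ℤ) (h : (2 ^ d - 1 : ℤ) ∣ VV W) :
    ∃ C : ZMod d → ℤ, (∀ i, W i = 2 * C i - C (i - 1)) ∧
      ∀ i, (2 ^ d - 1) * C i = VV (fun j => W (j + (i + 1))) := by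
  have h1 : ∀ m : ℕ, (2 ^ d - 1 : ℤ) ∣ VV (fun j : ZMod d => W (j - (m : ZMod d))) := by
    intro m
    have := VV_shift_pow W m
    have h0 : (2 ^ d - 1 : ℤ) ∣ 2 ^ m * VV W := Dvd.dvd.mul_left h _
    exact Int.dvd_of_emod_eq_zero (Eq.trans this (Int.emod_eq_zero_of_dvd h0))
  have h2 : ∀ i : ZMod d, (2 ^ d - 1 : ℤ) ∣ VV (fun j => W (j + (i + 1))) := by
    intro i
    have := h1 (-(i + 1)).val
    simpa [sub_eq_add_neg, add_comm] using this
  choose C hC using h2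
  refine ⟨C, fun i => ?_, fun i => (hC i).symm⟩
  have h3 := VV_shift (fun j => W (j + (i + 1)))
  have h4 : (fun j : ZMod d => (fun j => W (j + (i + 1))) (j - 1)) =
      fun j => W (j + ((i - 1) + 1)) := by
    funext j; simp only []; congr 1; ring
  rw [h4, hC, hC] at h3
  have h5 : (-1 : ZMod d) + (i + 1) = i := by ring
  rw [h5] at h3
  have h6 : (2 ^ d - 1 : ℤ) ≠ 0 := by
    have : (1 : ℤ) < 2 ^ d := one_lt_pow₀ (by norm_num) (NeZero.ne d)
    omega
  apply mul_left_cancel₀ h6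
  linarith

/-- bits of a natural number as a cyclic word -/
def bitsW (d : ℕ) (x : ℕ) : ZMod d → Bool := fun i => x.testBit i.val

lemma sum_ZMod_eq_range {d : ℕ} [NeZero d] {M : Type*} [AddCommMonoid M] (f : ℕ → M) :
    ∑ i : ZMod d, f i.val = ∑ i ∈ Finset.range d, f i := by
  obtain ⟨n, rfl⟩ : ∃ n, d = n + 1 := ⟨d - 1, by have := NeZero.ne d; omega⟩
  exact Fin.sum_univ_eq_sum_range f (n + 1)

lemma sum_testBit (d x : ℕ) (h : x < 2 ^ d) :
    ∑ i ∈ Finset.range d, bt (x.testBit i) * 2 ^ i = (x : ℤ) := by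
  induction d generalizing x with
  | zero => simp at h; simp [h]
  | succ d ih =>
    rw [Finset.sum_range_succ']
    have h1 : ∀ i, x.testBit (i + 1) = (x / 2).testBit i := fun i => Nat.testBit_succ x i
    simp only [h1, pow_succ]
    have h2 := ih (x / 2) (by rw [pow_succ] at h; omega)
    have h3 : ∑ i ∈ Finset.range d, bt ((x / 2).testBit i) * (2 ^ i * 2) = ((x / 2 : ℕ) : ℤ) * 2 := by
      rw [← h2, Finset.sum_mul]
      apply Finset.sum_congr rfl; intros; ring
    rw [h3, Nat.testBit_zero]
    rcases Nat.mod_two_eq_zero_or_one x with h4 | h4 <;> simp [h4, bt] <;> omega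

lemma count_testBit (d x : ℕ) (h : x < 2 ^ d) :
    (((Nat.digits 2 x).count 1 : ℕ) : ℤ) = ∑ i ∈ Finset.range d, bt (x.testBit i) := by
  induction d generalizing x with
  | zero => simp at h; simp [h]
  | succ d ih =>
    rw [Finset.sum_range_succ']
    have h1 : ∀ i, x.testBit (i + 1) = (x / 2).testBit i := fun i => Nat.testBit_succ x i
    simp only [h1]
    have h2 := ih (x / 2) (by rw [pow_succ] at h; omega)
    rw [← h2, Nat.testBit_zero]
    rcases Nat.eq_zero_or_pos x with h0 | h0
    · subst h0; simp [bt]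
    · rw [Nat.digits_def' (by norm_num) h0, List.count_cons]
      rcases Nat.mod_two_eq_zero_or_one x with h4 | h4 <;> simp [h4, bt]

lemma VV_bitsW {d : ℕ} [NeZero d] (x : ℕ) (h : x < 2 ^ d) :
    VV (fun i => bt (bitsW d x i)) = x := by
  rw [← sum_testBit d x h]
  exact sum_ZMod_eq_range (fun i => bt (x.testBit i) * 2 ^ i)

lemma VV_inj {d : ℕ} [NeZero d] {a b : ZMod d → Bool}
    (h : VV (fun i => bt (a i)) = VV (fun i => bt (b i))) : a = b := by
  have hlt : ∀ a : ZMod d → Bool, (VV (fun i => bt (a i))).toNat < 2 ^ d := by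
    intro a
    have h1 := VV_le a
    have h2 := VV_nonneg a
    zify
    rw [Int.toNat_of_nonneg h2]
    omega
  let f : (ZMod d → Bool) → Fin (2 ^ d) := fun a => ⟨(VV (fun i => bt (a i))).toNat, hlt a⟩
  have hs : Function.Surjective f := by
    rintro ⟨x, hx⟩
    refine ⟨bitsW d x, ?_⟩
    simp only [f]
    congr 1
    rw [VV_bitsW x hx]; simp
  have hb : Function.Bijective f := by
    rw [Fintype.bijective_iff_surjective_and_card]
    refine ⟨hs, ?_⟩
    simp [ZMod.card]
  apply hb.1
  simp only [f, h]

/-- number of ones -/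
def wt {d : ℕ} [NeZero d] (a : ZMod d → Bool) : ℤ := ∑ i, bt (a i)

lemma mod_lt_pow {d : ℕ} [NeZero d] (x : ℕ) : x % (2 ^ d - 1) < 2 ^ d - 1 := by
  apply Nat.mod_lt
  have : 1 < 2 ^ d := one_lt_pow₀ (by norm_num) (NeZero.ne d)
  omega

lemma sBin_eq {d : ℕ} [NeZero d] (x : ℕ) :
    (sBin d x : ℤ) = wt (bitsW d (x % (2 ^ d - 1))) := by
  have := mod_lt_pow (d := d) x
  unfold sBin wt
  rw [count_testBit d _ (by omega)]
  exact (sum_ZMod_eq_range (fun i => bt ((x % (2 ^ d - 1)).testBit i))).symm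

lemma cast_pow_sub (d : ℕ) : ((2 ^ d - 1 : ℕ) : ℤ) = 2 ^ d - 1 := by
  have : 1 ≤ 2 ^ d := Nat.one_le_two_pow
  push_cast [this]; ring

lemma bitsW_eq_of_modEq {d : ℕ} [NeZero d] (x : ℕ) (a : ZMod d → Bool) (j : ZMod d)
    (hj : a j = false) (h : (x : ℤ) ≡ VV (fun i => bt (a i)) [ZMOD (2 ^ d - 1)]) :
    bitsW d (x % (2 ^ d - 1)) = a := by
  apply VV_inj
  have := mod_lt_pow (d := d) x
  rw [VV_bitsW _ (by omega)]
  push_cast [cast_pow_sub]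
  rw [h, Int.emod_eq_of_lt (VV_nonneg a) (VV_lt a j hj)]

/-! ## Configurations -/

/-- local condition on the digits at place `j` -/
def okm {d : ℕ} (p : ℕ) (j : ZMod d) (u a : Bool) : Prop :=
  if j = -((p : ZMod d) + 1) then a = true ∧ u = false
  else if j = -1 then a = false ∧ u = true else (a = true → u = true)

/-- configurations (`a` = digits, `c` = carries, `u` = digits of the sum) -/
structure Cfg {d : ℕ} (E : Finset ℕ) (p : ℕ) (a c u : ZMod d → Bool) : Prop where
  eq : ∀ j : ZMod d, ∑ e ∈ E, bt (a (j - (e : ZMod d))) + bt (c (j - (p : ZMod d))) =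
    bt (u j) + 2 * bt (c j)
  ok : ∀ j, okm p j (u j) (a j)

abbrev W3 (d : ℕ) := (ZMod d → Bool) × (ZMod d → Bool) × (ZMod d → Bool)

open Classical in
noncomputable def CfgSet (d : ℕ) [NeZero d] (E : Finset ℕ) (p : ℕ) : Finset (W3 d) :=
  Finset.univ.filter fun w => Cfg E p w.1 w.2.1 w.2.2

/-- reindexing -/
def re {d : ℕ} (p : ℕ) (i0 : ZMod d) (w : ZMod d → Bool) : ZMod d → Bool :=
  fun i => w ((p : ZMod d) * (i - i0) - ((p : ZMod d) + 1))

lemma carry_unique {d : ℕ} {c c' : ZMod d → Bool}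
    (h : ∀ i, 2 * bt (c i) - bt (c (i - 1)) = 2 * bt (c' i) - bt (c' (i - 1))) : c = c' := by
  funext i
  have := h (i + 1)
  rw [add_sub_cancel_right] at this
  apply bt_inj
  have h1 := bt_nonneg (c i)
  have h2 := bt_le_one (c i)
  have h3 := bt_nonneg (c' i)
  have h4 := bt_le_one (c' i)
  omega

lemma VV_bt_shift_one {d : ℕ} [NeZero d] (c : ZMod d → Bool) :
    VV (fun i => bt (c (i - 1))) ≡ 2 * VV (fun i => bt (c i)) [ZMOD (2 ^ d - 1)] := by
  have := VV_shift_pow (fun i => bt (c i)) 1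
  simpa using this

lemma VV_sum_shift {d : ℕ} [NeZero d] (E : Finset ℕ) (m : ℕ) (a : ZMod d → Bool) :
    VV (fun i => ∑ e ∈ E, bt (a (i - (m : ZMod d) * (e : ZMod d)))) ≡
      (∑ e ∈ E, 2 ^ (m * e)) * VV (fun i => bt (a i)) [ZMOD (2 ^ d - 1)] := by
  rw [VV_sum E (fun e i => bt (a (i - (m : ZMod d) * (e : ZMod d)))), Finset.sum_mul]
  apply Int.ModEq.sum
  intro e _
  have := VV_shift_pow (fun i => bt (a i)) (m * e)
  push_cast at this
  exact this

/-- a configuration in natural order gives a solution -/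
lemma sol_of_natural {d : ℕ} [NeZero d] (hd : 1 < d) (E : Finset ℕ) (m k : ℕ) (hk1 : 1 ≤ k)
    (hk : (k : ℤ) ≡ ∑ e ∈ E, 2 ^ (m * e) [ZMOD (2 ^ d - 1)])
    (a b c u : ZMod d → Bool) (i0 : ZMod d)
    (h1 : ∀ i, ∑ e ∈ E, bt (a (i - (m : ZMod d) * (e : ZMod d))) + bt (c (i - 1)) =
      bt (u i) + 2 * bt (c i))
    (h2 : ∀ i, bt (a i) + bt (b i) + bt (decide (i - 1 = i0)) =
      bt (u i) + 2 * bt (decide (i = i0))) :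
    let x := (VV (fun i => bt (a i))).toNat
    x ∈ (Finset.Ioo 0 (2 ^ d - 1)).filter
      (fun a => sBin d a + sBin d ((k - 1) * a) = sBin d (k * a) + 1) ∧
    bitsW d (x % (2 ^ d - 1)) = a ∧ bitsW d (((k - 1) * x) % (2 ^ d - 1)) = b ∧
      bitsW d ((k * x) % (2 ^ d - 1)) = u := by
  intro x
  have : Fact (1 < d) := ⟨hd⟩
  have hne : i0 ≠ i0 + 1 := by simp
  have hne2 : i0 - 1 ≠ i0 := by simp
  have hi0 := h2 i0
  have hi1 := h2 (i0 + 1)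
  simp only [add_sub_cancel_right, decide_true, hne.symm, hne2, decide_false] at hi0 hi1
  have ha0 : a i0 = true := by
    cases ha : a i0 <;> cases hb : b i0 <;> cases hu : u i0 <;> simp_all [bt]
  have hu0 : u i0 = false := by
    cases ha : a i0 <;> cases hb : b i0 <;> cases hu : u i0 <;> simp_all [bt]
  have ha1 : a (i0 + 1) = false := by
    cases ha : a (i0 + 1) <;> cases hb : b (i0 + 1) <;> cases hu : u (i0 + 1) <;> simp_all [bt]
  have hb1 : b (i0 + 1) = false := by
    cases ha : a (i0 + 1) <;> cases hb : b (i0 + 1) <;> cases hu : u (i0 + 1) <;> simp_all [bt]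
  have hx : (x : ℤ) = VV (fun i => bt (a i)) := Int.toNat_of_nonneg (VV_nonneg a)
  have hu : ((k * x : ℕ) : ℤ) ≡ VV (fun i => bt (u i)) [ZMOD (2 ^ d - 1)] := by
    have e1 : VV (fun i => ∑ e ∈ E, bt (a (i - (m : ZMod d) * (e : ZMod d)))) +
        VV (fun i => bt (c (i - 1))) = VV (fun i => bt (u i)) + 2 * VV (fun i => bt (c i)) := by
      rw [← VV_mul, ← VV_add, ← VV_add]
      congr 1
      funext i
      exact h1 i
    have e2 := (VV_sum_shift E m a).add (VV_bt_shift_one c)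
    rw [e1] at e2
    have e3 := Int.ModEq.add_right_cancel' _ e2
    push_cast
    rw [hx]
    exact (hk.mul_right _).trans e3.symm
  have hb : (((k - 1) * x : ℕ) : ℤ) ≡ VV (fun i => bt (b i)) [ZMOD (2 ^ d - 1)] := by
    have e1 : VV (fun i => bt (a i)) + VV (fun i => bt (b i)) +
        VV (fun i => bt ((fun j => decide (j = i0)) (i - 1))) =
        VV (fun i => bt (u i)) + 2 * VV (fun i => bt ((fun j => decide (j = i0)) i)) := by
      rw [← VV_mul, ← VV_add, ← VV_add, ← VV_add]
      congr 1
      funext i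
      exact h2 i
    have e2 := VV_bt_shift_one (fun j => decide (j = i0))
    have e3 := e2.add_left (VV (fun i => bt (a i)) + VV (fun i => bt (b i)))
    rw [e1] at e3
    have e4 := Int.ModEq.add_right_cancel' _ e3
    have e5 := hu.trans e4
    push_cast [hk1] at e5 ⊢
    rw [← hx] at e5
    have e6 := e5.sub_right (x : ℤ)
    have e7 : (k : ℤ) * x - x = ((k : ℤ) - 1) * x := by ring
    rw [e7, add_sub_cancel_left] at e6
    exact e6
  have ra := bitsW_eq_of_modEq x a (i0 + 1) ha1 (by rw [hx])
  have rb := bitsW_eq_of_modEq _ b (i0 + 1) hb1 hb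
  have ru := bitsW_eq_of_modEq _ u i0 hu0 hu
  refine ⟨?_, ra, rb, ru⟩
  rw [Finset.mem_filter, Finset.mem_Ioo]
  refine ⟨⟨?_, ?_⟩, ?_⟩
  · rcases Nat.eq_zero_or_pos x with h0 | h0
    · rw [h0] at ra
      have := congrFun ra i0
      rw [ha0] at this
      simp [bitsW] at this
    · exact h0
  · have := VV_lt a _ ha1
    zify
    rw [hx, cast_pow_sub]
    exact this
  · zify
    rw [sBin_eq, sBin_eq, sBin_eq, ra, rb, ru]
    have e1 : ∑ i, (bt (a i) + bt (b i) + bt (decide (i - 1 = i0))) =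
        ∑ i, (bt (u i) + 2 * bt (decide (i = i0))) := Finset.sum_congr rfl fun i _ => h2 i
    have e2 : ∑ i : ZMod d, bt (decide (i = i0)) = 1 := by simp [bt, Bool.cond_decide]
    have e3 : ∑ i : ZMod d, bt (decide (i - 1 = i0)) = 1 := by
      simp [bt, sub_eq_iff_eq_add, Bool.cond_decide]
    simp only [Finset.sum_add_distrib, ← Finset.mul_sum, e2, e3] at e1
    unfold wt
    linarith

/-- the word `b` -/
def bword {d : ℕ} (i0 : ZMod d) (a u : ZMod d → Bool) : ZMod d → Bool :=
  fun i => if i = i0 then true else if i - 1 = i0 then false else u i && !a i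

lemma natural_of_cfg {d : ℕ} [NeZero d] (hd : 1 < d) (E : Finset ℕ) (p m : ℕ)
    (hpm : (p : ZMod d) * m = 1) (a c u : ZMod d → Bool) (h : Cfg E p a c u) (i0 : ZMod d) :
    (∀ i, ∑ e ∈ E, bt (re p i0 a (i - (m : ZMod d) * (e : ZMod d))) + bt (re p i0 c (i - 1)) =
      bt (re p i0 u i) + 2 * bt (re p i0 c i)) ∧
    (∀ i, bt (re p i0 a i) + bt (bword i0 (re p i0 a) (re p i0 u) i) + bt (decide (i - 1 = i0)) =
      bt (re p i0 u i) + 2 * bt (decide (i = i0))) := by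
  have : Fact (1 < d) := ⟨hd⟩
  constructor
  · intro i
    have := h.eq ((p : ZMod d) * (i - i0) - ((p : ZMod d) + 1))
    unfold re
    rw [← this]
    congr 1
    · apply Finset.sum_congr rfl
      intro e _
      congr 2
      linear_combination (-(e : ZMod d)) * hpm
    · congr 2
      ring
  · intro i
    have hok := h.ok ((p : ZMod d) * (i - i0) - ((p : ZMod d) + 1))
    unfold okm at hok
    have hc : ∀ y z : ZMod d, (p : ZMod d) * y = p * z → y = z := by
      intro y z hyz
      linear_combination (m : ZMod d) * hyz + (z - y) * hpm
    have q1 : ((p : ZMod d) * (i - i0) - ((p : ZMod d) + 1) = -((p : ZMod d) + 1)) ↔ i = i0 := by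
      constructor
      · intro h
        have := hc (i - i0) 0 (by linear_combination h)
        linear_combination this
      · rintro rfl; ring
    have q2 : ((p : ZMod d) * (i - i0) - ((p : ZMod d) + 1) = -1) ↔ i - 1 = i0 := by
      constructor
      · intro h
        have := hc (i - i0) 1 (by linear_combination h)
        linear_combination this
      · intro h; rw [← h]; ring
    simp only [q1, q2] at hok
    have hAe : re p i0 a i = a ((p : ZMod d) * (i - i0) - ((p : ZMod d) + 1)) := rfl
    have hUe : re p i0 u i = u ((p : ZMod d) * (i - i0) - ((p : ZMod d) + 1)) := rfl
    rw [← hAe, ← hUe] at hok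
    unfold bword
    generalize re p i0 a i = A at *
    generalize re p i0 u i = U at *
    by_cases r1 : i = i0
    · have r2 : ¬ (i - 1 = i0) := by rw [r1]; simp
      simp only [r1, if_true] at hok
      rw [hok.1, hok.2]
      subst r1
      simp [bt, r2]
    · by_cases r2 : i - 1 = i0
      · simp only [r1, if_false, r2, if_true] at hok
        simp [hok.1, hok.2, r1, r2, bt]
      · simp only [r1, if_false, r2] at hok
        simp only [r1, r2, if_false, decide_false]
        revert hok
        clear * -
        cases A <;> cases U <;> simp [bt]


/-- the solution attached to a configuration and a position -/
def phi {d : ℕ} [NeZero d] (p : ℕ) (w : ZMod d × W3 d) : ℕ :=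
  (VV (fun i => bt (re p w.1 w.2.1 i))).toNat

lemma re_inj {d : ℕ} (p m : ℕ) (hpm : (p : ZMod d) * m = 1) (i0 : ZMod d)
    {a a' : ZMod d → Bool} (h : re p i0 a = re p i0 a') : a = a' := by
  funext j
  have := congrFun h (i0 + m * (j + (p + 1)))
  unfold re at this
  have e : (p : ZMod d) * (i0 + m * (j + (p + 1)) - i0) - (p + 1) = j := by
    linear_combination (j + (p + 1)) * hpm
  rwa [e] at this

theorem B_ge {d : ℕ} [NeZero d] (hd : 1 < d) (E : Finset ℕ) (p m k : ℕ) (hk1 : 1 ≤ k)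
    (hpm : (p : ZMod d) * m = 1)
    (hk : (k : ℤ) ≡ ∑ e ∈ E, 2 ^ (m * e) [ZMOD (2 ^ d - 1)]) :
    d * (CfgSet d E p).card ≤ B k d := by
  classical
  have hcard : ((Finset.univ : Finset (ZMod d)) ×ˢ CfgSet d E p).card = d * (CfgSet d E p).card := by
    rw [Finset.card_product, Finset.card_univ, ZMod.card]
  rw [← hcard]
  unfold B
  apply Finset.card_le_card_of_injOn (phi p)
  · rintro ⟨i0, a, c, u⟩ hw
    simp only [CfgSet, Finset.coe_product, Finset.coe_univ, Finset.coe_filter, Set.mem_prod,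
      Set.mem_univ, Finset.mem_univ, true_and, Set.mem_ofPred_eq] at hw
    obtain ⟨h1, h2⟩ := natural_of_cfg hd E p m hpm a c u hw i0
    exact (sol_of_natural hd E m k hk1 hk _ _ _ _ i0 h1 h2).1
  · rintro ⟨i0, a, c, u⟩ hw ⟨i0', a', c', u'⟩ hw' heq
    simp only [CfgSet, Finset.coe_product, Finset.coe_univ, Finset.coe_filter, Set.mem_prod,
      Set.mem_univ, Finset.mem_univ, true_and, Set.mem_ofPred_eq] at hw hw'
    obtain ⟨h1, h2⟩ := natural_of_cfg hd E p m hpm a c u hw i0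
    obtain ⟨h1', h2'⟩ := natural_of_cfg hd E p m hpm a' c' u' hw' i0'
    obtain ⟨-, ra, rb, ru⟩ := sol_of_natural hd E m k hk1 hk _ _ _ _ i0 h1 h2
    obtain ⟨-, ra', rb', ru'⟩ := sol_of_natural hd E m k hk1 hk _ _ _ _ i0' h1' h2'
    unfold phi at heq
    simp only at heq
    rw [heq] at ra rb ru
    have qa := ra.symm.trans ra'
    have qb := rb.symm.trans rb'
    have qu := ru.symm.trans ru'
    have hc : re p i0 c = re p i0' c' := by
      apply carry_unique
      intro i
      have e1 := h1 i
      have e2 := h1' i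
      rw [← qa, ← qu] at e2
      linarith
    have hi : (fun j => decide (j = i0)) = (fun j => decide (j = i0')) := by
      apply carry_unique
      intro i
      have e1 := h2 i
      have e2 := h2' i
      rw [congrFun qa i, congrFun qb i, congrFun qu i] at e1
      linarith
    have hi0 : i0 = i0' := by
      have := congrFun hi i0
      simpa using this
    subst hi0
    rw [re_inj p m hpm i0 qa, re_inj p m hpm i0 hc, re_inj p m hpm i0 qu]

lemma zero_or_one_of_bound {n C : ℤ} (hn : 0 < n) (h1 : -n < n * C) (h2 : n * C < 2 * n) :
    C = 0 ∨ C = 1 := by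
  have h3 : -1 < C := by nlinarith
  have h4 : C < 2 := by nlinarith
  omega

lemma bitsW_false {d : ℕ} [NeZero d] (x : ℕ) :
    ∃ j, bitsW d (x % (2 ^ d - 1)) j = false := by
  apply exists_false_of_VV_lt
  have := mod_lt_pow (d := d) x
  rw [VV_bitsW _ (by omega), ← cast_pow_sub]
  exact_mod_cast this

lemma VV_rot_bounds {d : ℕ} [NeZero d] (a : ZMod d → Bool) (h : ∃ j, a j = false) (r : ZMod d) :
    0 ≤ VV (fun j => bt (a (j + r))) ∧ VV (fun j => bt (a (j + r))) ≤ 2 ^ d - 2 := by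
  obtain ⟨j, hj⟩ := h
  have h1 := VV_nonneg (fun j => a (j + r))
  have h2 := VV_lt (fun j => a (j + r)) (j - r) (by simpa using hj)
  constructor
  · exact h1
  · omega

lemma bt_decide_eq_one {C : ℤ} (h : C = 0 ∨ C = 1) : bt (decide (C = 1)) = C := by
  rcases h with h | h <;> simp [h, bt]

lemma VV_bitsW_mod {d : ℕ} [NeZero d] (x : ℕ) :
    VV (fun i => bt (bitsW d (x % (2 ^ d - 1)) i)) ≡ x [ZMOD (2 ^ d - 1)] := by
  have := mod_lt_pow (d := d) x
  rw [VV_bitsW _ (by omega)]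
  push_cast [cast_pow_sub]
  exact Int.mod_modEq _ _

theorem B_le {d : ℕ} [NeZero d] (hd : 1 < d) (E : Finset ℕ) (hE : E.card = 2)
    (p m k : ℕ) (hk1 : 1 ≤ k)
    (hpm : (p : ZMod d) * m = 1)
    (hk : (k : ℤ) ≡ ∑ e ∈ E, 2 ^ (m * e) [ZMOD (2 ^ d - 1)]) :
    B k d ≤ d * (CfgSet d E p).card := by
  classical
  have : Fact (1 < d) := ⟨hd⟩
  have hcard : ((Finset.univ : Finset (ZMod d)) ×ˢ CfgSet d E p).card = d * (CfgSet d E p).card := by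
    rw [Finset.card_product, Finset.card_univ, ZMod.card]
  rw [← hcard]
  unfold B
  refine (Finset.card_le_card ?_).trans (Finset.card_image_le (f := phi p))
  intro x hx
  rw [Finset.mem_filter, Finset.mem_Ioo] at hx
  obtain ⟨⟨hx0, hxN⟩, hs⟩ := hx
  have hNpos : (0 : ℤ) < 2 ^ d - 1 := by
    have : (1 : ℤ) < 2 ^ d := one_lt_pow₀ (by norm_num) (NeZero.ne d)
    omega
  zify at hs
  rw [sBin_eq, sBin_eq, sBin_eq] at hs
  have ma := VV_bitsW_mod (d := d) x
  have mb := VV_bitsW_mod (d := d) ((k - 1) * x)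
  have mu := VV_bitsW_mod (d := d) (k * x)
  have fa := bitsW_false (d := d) x
  have fb := bitsW_false (d := d) ((k - 1) * x)
  have fu := bitsW_false (d := d) (k * x)
  have hax : VV (fun i => bt (bitsW d (x % (2 ^ d - 1)) i)) = x := by
    rw [Nat.mod_eq_of_lt hxN, VV_bitsW _ (by omega)]
  generalize bitsW d (x % (2 ^ d - 1)) = a at *
  generalize bitsW d ((k - 1) * x % (2 ^ d - 1)) = b at *
  generalize bitsW d (k * x % (2 ^ d - 1)) = u at *
  obtain ⟨K, hK1, hK2⟩ := exists_carry (fun i => bt (a i) + bt (b i) - bt (u i)) (by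
    rw [VV_sub, VV_add]
    apply Int.dvd_of_emod_eq_zero
    have := (ma.add mb).sub mu
    push_cast [hk1] at this
    rw [show (x : ℤ) + ((k : ℤ) - 1) * x - k * x = 0 by ring] at this
    exact this)
  have hK : ∀ i, K i = 0 ∨ K i = 1 := by
    intro i
    have e := hK2 i
    rw [VV_sub (fun j => bt (a (j + (i + 1))) + bt (b (j + (i + 1)))) (fun j => bt (u (j + (i + 1)))),
      VV_add] at e
    have b1 := VV_rot_bounds a fa (i + 1)
    have b2 := VV_rot_bounds b fb (i + 1)
    have b3 := VV_rot_bounds u fu (i + 1)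
    exact zero_or_one_of_bound hNpos (by rw [e]; linarith) (by rw [e]; linarith)
  have hKs : ∑ i, K i = 1 := by
    have e1 : ∑ i, (bt (a i) + bt (b i) - bt (u i)) = ∑ i, (2 * K i - K (i - 1)) :=
      Finset.sum_congr rfl fun i _ => hK1 i
    have e2 : ∑ i, K (i - 1) = ∑ i, K i := Equiv.sum_comp (Equiv.subRight (1 : ZMod d)) K
    rw [Finset.sum_sub_distrib, Finset.sum_sub_distrib, Finset.sum_add_distrib, ← Finset.mul_sum,
      e2] at e1
    unfold wt at hs
    linarith
  obtain ⟨i0, -, hi0⟩ : ∃ i ∈ Finset.univ, K i ≠ 0 :=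
    Finset.exists_ne_zero_of_sum_ne_zero (by rw [hKs]; norm_num)
  have hi1 : K i0 = 1 := (hK i0).resolve_left hi0
  have hKd : ∀ i, K i = bt (decide (i = i0)) := by
    intro i
    by_cases h : i = i0
    · simp [h, hi1, bt]
    · simp only [h, decide_false, bt, cond_false]
      rw [← Finset.add_sum_erase _ _ (Finset.mem_univ i0), hi1] at hKs
      have h0 : ∑ i ∈ Finset.univ.erase i0, K i = 0 := by linarith
      rw [Finset.sum_eq_zero_iff_of_nonneg
        (fun i _ => by rcases hK i with h | h <;> simp [h])] at h0
      exact h0 i (by simp [h])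
  obtain ⟨C, hC1, hC2⟩ := exists_carry
    (fun i => (∑ e ∈ E, bt (a (i - (m : ZMod d) * (e : ZMod d)))) - bt (u i)) (by
    rw [VV_sub]
    apply Int.dvd_of_emod_eq_zero
    have e1 := (VV_sum_shift E m a).trans (hk.symm.mul_right _)
    rw [hax] at e1
    have := e1.sub mu
    push_cast at this
    rw [sub_self] at this
    exact this)
  have hC : ∀ i, C i = 0 ∨ C i = 1 := by
    intro i
    have e := hC2 i
    rw [VV_sub (fun j => ∑ e ∈ E, bt (a (j + (i + 1) - (m : ZMod d) * (e : ZMod d))))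
      (fun j => bt (u (j + (i + 1)))),
      VV_sum E (fun e j => bt (a (j + (i + 1) - (m : ZMod d) * (e : ZMod d))))] at e
    have b1 : ∀ e ∈ E, 0 ≤ VV (fun j => bt (a (j + (i + 1) - (m : ZMod d) * (e : ZMod d)))) ∧
        VV (fun j => bt (a (j + (i + 1) - (m : ZMod d) * (e : ZMod d)))) ≤ 2 ^ d - 2 := by
      intro e _
      have := VV_rot_bounds a fa ((i + 1) - (m : ZMod d) * (e : ZMod d))
      simpa only [add_sub_assoc] using this
    have b2 := Finset.sum_nonneg fun e he => (b1 e he).1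
    have b4 := Finset.sum_le_card_nsmul E _ _ fun e he => (b1 e he).2
    have b3 := VV_rot_bounds u fu (i + 1)
    rw [hE] at b4
    simp only [nsmul_eq_mul, Nat.cast_ofNat] at b4
    exact zero_or_one_of_bound hNpos (by rw [e]; linarith) (by rw [e]; linarith)
  let pull : (ZMod d → Bool) → ZMod d → Bool := fun w j => w (i0 + m * (j + (p + 1)))
  have hpull : ∀ w, re p i0 (pull w) = w := by
    intro w
    funext i
    simp only [re, pull]
    congr 1
    linear_combination (i - i0) * hpm
  rw [Finset.mem_image]
  refine ⟨(i0, pull a, pull (fun i => decide (C i = 1)), pull u), ?_, ?_⟩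
  · simp only [CfgSet, Finset.mem_product, Finset.mem_univ, true_and, Finset.mem_filter]
    constructor
    · intro j
      have e1 := hC1 (i0 + m * (j + (p + 1)))
      simp only [pull, bt_decide_eq_one (hC _)]
      have e2 : (i0 + (m : ZMod d) * (j - p + (p + 1))) = i0 + m * (j + (p + 1)) - 1 := by
        linear_combination -hpm
      have e3 : ∑ e ∈ E, bt (a (i0 + (m : ZMod d) * (j - e + (p + 1)))) =
          ∑ e ∈ E, bt (a (i0 + (m : ZMod d) * (j + (p + 1)) - (m : ZMod d) * e)) := by
        apply Finset.sum_congr rfl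
        intro e _
        congr 2
        ring
      rw [e2, e3]
      linarith
    · intro j
      have e1 := hK1 (i0 + m * (j + (p + 1)))
      simp only [hKd] at e1
      have hm0 : ∀ y : ZMod d, (m : ZMod d) * y = 0 → y = 0 := by
        intro y hy
        linear_combination (p : ZMod d) * hy - y * hpm
      have q1 : (i0 + (m : ZMod d) * (j + (p + 1)) = i0) ↔ j = -((p : ZMod d) + 1) := by
        constructor
        · intro h
          have := hm0 (j + (p + 1)) (by linear_combination h)
          linear_combination this
        · rintro rfl; ring
      have q2 : (i0 + (m : ZMod d) * (j + (p + 1)) - 1 = i0) ↔ j = -1 := by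
        constructor
        · intro h
          have := hm0 (j + 1) (by linear_combination h - hpm)
          linear_combination this
        · rintro rfl; linear_combination hpm
      simp only [q1, q2] at e1
      unfold okm
      simp only [pull]
      have hp0 : (p : ZMod d) ≠ 0 := by
        intro h; rw [h, zero_mul] at hpm; exact zero_ne_one hpm
      generalize a (i0 + (m : ZMod d) * (j + (p + 1))) = A at *
      generalize u (i0 + (m : ZMod d) * (j + (p + 1))) = U at *
      generalize b (i0 + (m : ZMod d) * (j + (p + 1))) = Bb at *
      by_cases r1 : j = -((p : ZMod d) + 1)
      · have r2 : ¬ (j = -1) := by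
          intro h
          apply hp0
          rw [h] at r1
          linear_combination r1
        simp only [r1, decide_true, if_true] at e1 ⊢
        rw [← r1] at e1
        simp only [r2, decide_false] at e1
        cases A <;> cases U <;> cases Bb <;> simp [bt] at e1 ⊢
      · by_cases r2 : j = -1
        · simp only [r2, decide_true, if_true] at e1 ⊢
          rw [← r2] at e1 ⊢
          simp only [r1, decide_false, if_false] at e1 ⊢
          cases A <;> cases U <;> cases Bb <;> simp [bt] at e1 ⊢
        · simp only [r1, r2, decide_false, if_false] at e1 ⊢
          cases A <;> cases U <;> cases Bb <;> simp [bt] at e1 ⊢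
  · unfold phi
    simp only [hpull, hax]
    simp

/-! ## Closed walks in an automaton -/

/-- type of a step: normal, the place of the carry, and the place after the carry -/
inductive Md | nrm | one | zer

/-- type of the step when `r` steps remain -/
def modeR (p r : ℕ) : Md := bif Nat.beq r (p + 1) then Md.one else bif Nat.beq r 1 then Md.zer else Md.nrm

/-- allowed digit `a` given the digit `u` -/
def alw : Md → Bool → Bool → Bool
  | Md.nrm, u, a => !a || u
  | Md.one, u, a => a && !u
  | Md.zer, u, a => !a && u

/-- an automaton -/
structure Aut (σ : Type) where
  nx : σ → Bool → σ
  uu : σ → Bool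
  cr : σ → Bool
  ok : σ → Bool

/-- transfer operator -/
def stepM {σ : Type} (M : Aut σ) (m : Md) (v : σ → ℕ) (s : σ) : ℕ :=
  bif M.ok s then
    (bif alw m (M.uu s) false then v (M.nx s false) else 0) +
    (bif alw m (M.uu s) true then v (M.nx s true) else 0)
  else 0

/-- number of walks of length `r` from `s` to `t` -/
def cnt {σ : Type} [DecidableEq σ] (M : Aut σ) (p : ℕ) (t : σ) : ℕ → σ → ℕ
  | 0 => fun s => if s = t then 1 else 0
  | r + 1 => stepM M (modeR p (r + 1)) (cnt M p t r)

/-- label words of the walks of length `r` from `s` to `t` -/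
def Lw {σ : Type} [DecidableEq σ] (M : Aut σ) (p : ℕ) (t : σ) : ℕ → σ → Finset (List Bool)
  | 0 => fun s => if s = t then {[]} else ∅
  | r + 1 => fun s =>
    if M.ok s then
      (if alw (modeR p (r + 1)) (M.uu s) false then
        (Lw M p t r (M.nx s false)).map ⟨List.cons false, List.cons_injective⟩ else ∅) ∪
      (if alw (modeR p (r + 1)) (M.uu s) true then
        (Lw M p t r (M.nx s true)).map ⟨List.cons true, List.cons_injective⟩ else ∅)
    else ∅

lemma card_Lw {σ : Type} [DecidableEq σ] (M : Aut σ) (p : ℕ) (t : σ) (r : ℕ) (s : σ) :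
    (Lw M p t r s).card = cnt M p t r s := by
  induction r generalizing s with
  | zero => simp only [Lw, cnt]; split_ifs <;> simp
  | succ r ih =>
    simp only [Lw, cnt, stepM]
    cases M.ok s
    · simp
    · simp only [if_true, cond_true]
      rw [Finset.card_union_of_disjoint]
      · congr 1
        · cases alw (modeR p (r + 1)) (M.uu s) false <;> simp [ih]
        · cases alw (modeR p (r + 1)) (M.uu s) true <;> simp [ih]
      · rw [Finset.disjoint_left]
        intro l h1 h2
        split_ifs at h1 h2 <;> simp at h1 h2
        obtain ⟨l1, _, rfl⟩ := h1
        obtain ⟨l2, _, h3⟩ := h2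
        simp at h3

lemma mem_Lw {σ : Type} [DecidableEq σ] (M : Aut σ) (p : ℕ) (t : σ) (r : ℕ) (s : σ)
    (l : List Bool) :
    l ∈ Lw M p t r s ↔ l.length = r ∧ l.foldl M.nx s = t ∧ ∀ i < r,
      M.ok ((l.take i).foldl M.nx s) = true ∧
      alw (modeR p (r - i)) (M.uu ((l.take i).foldl M.nx s)) (l.getD i false) = true := by
  induction r generalizing s l with
  | zero =>
    simp only [Lw]
    split_ifs with h
    · subst h
      simp only [Finset.mem_singleton]
      constructor
      · rintro rfl; simp
      · rintro ⟨h, -⟩; exact List.length_eq_zero_iff.1 h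
    · simp only [Finset.notMem_empty, false_iff]
      rintro ⟨h1, h2, -⟩
      rw [List.length_eq_zero_iff.1 h1] at h2
      exact h h2
  | succ r ih =>
    have key : ∀ b l', (b :: l' ∈ Lw M p t (r + 1) s ↔ M.ok s = true ∧
        alw (modeR p (r + 1)) (M.uu s) b = true ∧ l' ∈ Lw M p t r (M.nx s b)) := by
      intro b l'
      simp only [Lw]
      cases M.ok s <;> cases h1 : alw (modeR p (r + 1)) (M.uu s) false <;>
        cases h2 : alw (modeR p (r + 1)) (M.uu s) true <;> cases b <;> simp [h1, h2]
    cases l with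
    | nil =>
      constructor
      · intro h
        simp only [Lw] at h
        split_ifs at h <;> simp at h
      · rintro ⟨h, -⟩; simp at h
    | cons b l' =>
      rw [key, ih]
      constructor
      · rintro ⟨h1, h2, h3, h4, h5⟩
        refine ⟨by simp [h3], by simpa using h4, ?_⟩
        intro i hi
        cases i with
        | zero => simpa using ⟨h1, h2⟩
        | succ i =>
          have := h5 i (by omega)
          simpa using this
      · rintro ⟨h3, h4, h5⟩
        have h0 := h5 0 (by omega)
        simp only [List.take_zero, List.foldl_nil, Nat.sub_zero, List.getD_cons_zero] at h0
        refine ⟨h0.1, h0.2, by simpa using h3, by simpa using h4, ?_⟩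
        intro i hi
        have := h5 (i + 1) (by omega)
        simpa using this

lemma foldl_take_succ {σ : Type} (f : σ → Bool → σ) (s : σ) (l : List Bool) (i : ℕ)
    (h : i < l.length) :
    (l.take (i + 1)).foldl f s = f ((l.take i).foldl f s) (l.getD i false) := by
  rw [List.take_add_one, List.foldl_append]
  simp [List.getD, h]

/-- the configuration attached to a walk -/
def psi {σ : Type} (M : Aut σ) (d : ℕ) (w : (_ : σ) × List Bool) : W3 d :=
  (fun j => w.2.getD j.val false, fun j => M.cr ((w.2.take j.val).foldl M.nx w.1),
    fun j => M.uu ((w.2.take j.val).foldl M.nx w.1))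

lemma eq_neg_iff {d : ℕ} [NeZero d] (j : ZMod d) (q : ℕ) (hq : 0 < q) (hqd : q ≤ d) :
    j = -(q : ZMod d) ↔ d - j.val = q := by
  have hj := ZMod.val_lt j
  have h1 : j = -(q : ZMod d) ↔ ((j.val + q : ℕ) : ZMod d) = 0 := by
    push_cast
    rw [ZMod.natCast_zmod_val]
    exact eq_neg_iff_add_eq_zero
  rw [h1, ZMod.natCast_eq_zero_iff]
  constructor
  · rintro ⟨c, hc⟩
    have h2 : c = 1 := by
      have h3 : 0 < c := by
        rcases Nat.eq_zero_or_pos c with h | h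
        · subst h; omega
        · exact h
      have h4 : c < 2 := by
        by_contra h5
        have : d * 2 ≤ d * c := Nat.mul_le_mul_left d (by omega)
        omega
      omega
    subst h2
    omega
  · intro h
    exact ⟨1, by omega⟩

lemma okm_iff {d : ℕ} [NeZero d] (p : ℕ) (hpd : p + 1 ≤ d) (j : ZMod d) (u a : Bool) :
    okm p j u a ↔ alw (modeR p (d - j.val)) u a = true := by
  have h1 := eq_neg_iff j (p + 1) (by omega) hpd
  have h2 := eq_neg_iff j 1 (by omega) (by omega)
  push_cast at h1 h2
  unfold okm modeR
  simp only [h1, h2]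
  by_cases h3 : d - j.val = p + 1
  · have : Nat.beq (d - j.val) (p + 1) = true := by rw [Nat.beq_eq]; exact h3
    rw [if_pos h3, this]
    cases u <;> cases a <;> simp [alw]
  · have h3' : Nat.beq (d - j.val) (p + 1) = false := by
      rw [← Bool.not_eq_true, Nat.beq_eq]; exact h3
    rw [if_neg h3, h3']
    by_cases h4 : d - j.val = 1
    · have : Nat.beq (d - j.val) 1 = true := by rw [Nat.beq_eq]; exact h4
      rw [if_pos h4, this]
      cases u <;> cases a <;> simp [alw]
    · have h4' : Nat.beq (d - j.val) 1 = false := by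
        rw [← Bool.not_eq_true, Nat.beq_eq]; exact h4
      rw [if_neg h4, h4']
      cases u <;> cases a <;> simp [alw]

lemma val_succ_cases {d : ℕ} [NeZero d] (j : ZMod d) :
    (j.val + 1 < d ∧ (j + 1).val = j.val + 1) ∨ (j.val + 1 = d ∧ (j + 1).val = 0) := by
  have hj := ZMod.val_lt j
  have h1 : (j + 1).val = (j.val + 1) % d := by
    have : ((j.val + 1 : ℕ) : ZMod d) = j + 1 := by push_cast; rw [ZMod.natCast_zmod_val]
    rw [← this, ZMod.val_natCast]
  rcases Nat.lt_or_ge (j.val + 1) d with h | h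
  · left; exact ⟨h, by rw [h1, Nat.mod_eq_of_lt h]⟩
  · right
    have : j.val + 1 = d := by omega
    exact ⟨this, by rw [h1, this, Nat.mod_self]⟩

/-- total number of closed walks -/
def FF {σ : Type} [DecidableEq σ] [Fintype σ] (M : Aut σ) (p d : ℕ) : ℕ := ∑ t, cnt M p t d t

lemma card_walks {σ : Type} [DecidableEq σ] [Fintype σ] (M : Aut σ) (p d : ℕ) :
    ((Finset.univ : Finset σ).sigma (fun t => Lw M p t d t)).card = FF M p d := by
  rw [Finset.card_sigma]
  simp only [card_Lw, FF]

theorem walks_le {σ : Type} [DecidableEq σ] [Fintype σ] (M : Aut σ) (d : ℕ) [NeZero d]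
    (E : Finset ℕ) (p : ℕ) (hpd : p + 1 ≤ d)
    (H1 : ∀ (st : ZMod d → σ) (a : ZMod d → Bool), (∀ j, st (j + 1) = M.nx (st j) (a j)) →
      (∀ j, M.ok (st j) = true) → ∀ j : ZMod d, ∑ e ∈ E, bt (a (j - (e : ZMod d))) +
        bt (M.cr (st (j - (p : ZMod d)))) = bt (M.uu (st j)) + 2 * bt (M.cr (st j)))
    (H2 : ∀ (st st' : ZMod d → σ) (a : ZMod d → Bool), (∀ j, st (j + 1) = M.nx (st j) (a j)) →
      (∀ j, st' (j + 1) = M.nx (st' j) (a j)) → (∀ j, M.cr (st j) = M.cr (st' j)) →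
      st 0 = st' 0) :
    FF M p d ≤ (CfgSet d E p).card := by
  classical
  rw [← card_walks]
  have walk : ∀ (t : σ) (l : List Bool), l ∈ Lw M p t d t → ∀ j : ZMod d,
      (l.take (j + 1).val).foldl M.nx t =
        M.nx ((l.take j.val).foldl M.nx t) (l.getD j.val false) := by
    intro t l hl j
    rw [mem_Lw] at hl
    obtain ⟨h1, h2, -⟩ := hl
    have hj := ZMod.val_lt j
    rw [← foldl_take_succ M.nx t l j.val (by omega)]
    rcases val_succ_cases j with ⟨_, h4⟩ | ⟨h3, h4⟩
    · rw [h4]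
    · rw [h4, h3, ← h1, List.take_length, h2]; simp
  apply Finset.card_le_card_of_injOn (psi M d)
  · rintro ⟨t, l⟩ hw
    simp only [Finset.coe_sigma, Set.mem_sigma_iff, Finset.coe_univ, Set.mem_univ, true_and,
      Finset.mem_coe] at hw
    have hl := (mem_Lw _ _ _ _ _ _).1 hw
    simp only [CfgSet, Finset.coe_filter, Finset.mem_univ, true_and, Set.mem_ofPred_eq]
    constructor
    · exact H1 (fun j => (l.take j.val).foldl M.nx t) (fun j => l.getD j.val false)
        (walk t l hw) (fun j => (hl.2.2 j.val (ZMod.val_lt j)).1)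
    · intro j
      rw [okm_iff p hpd]
      exact (hl.2.2 j.val (ZMod.val_lt j)).2
  · rintro ⟨t, l⟩ hw ⟨t', l'⟩ hw' heq
    simp only [Finset.coe_sigma, Set.mem_sigma_iff, Finset.coe_univ, Set.mem_univ, true_and,
      Finset.mem_coe] at hw hw'
    have hl := (mem_Lw _ _ _ _ _ _).1 hw
    have hl' := (mem_Lw _ _ _ _ _ _).1 hw'
    simp only [psi, Prod.mk.injEq] at heq
    obtain ⟨e1, e2, -⟩ := heq
    have hll : l = l' := by
      apply List.ext_getElem (by rw [hl.1, hl'.1])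
      intro i h h'
      have := congrFun e1 (i : ZMod d)
      rw [hl.1] at h
      simp only [ZMod.val_natCast, Nat.mod_eq_of_lt h] at this
      rw [← hl.1] at h
      simpa [List.getD, h, h'] using this
    subst hll
    have := H2 _ _ _ (walk t l hw) (walk t' l hw') (fun j => congrFun e2 j)
    simp at this
    rw [this]

theorem le_walks {σ : Type} [DecidableEq σ] [Fintype σ] (M : Aut σ) (d : ℕ) [NeZero d]
    (E : Finset ℕ) (p : ℕ) (hpd : p + 1 ≤ d)
    (H : ∀ a c u : ZMod d → Bool, (∀ j : ZMod d, ∑ e ∈ E, bt (a (j - (e : ZMod d))) +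
        bt (c (j - (p : ZMod d))) = bt (u j) + 2 * bt (c j)) →
      ∃ st : ZMod d → σ, (∀ j, st (j + 1) = M.nx (st j) (a j)) ∧ (∀ j, M.ok (st j) = true) ∧
        (∀ j, M.uu (st j) = u j) ∧ (∀ j, M.cr (st j) = c j)) :
    (CfgSet d E p).card ≤ FF M p d := by
  classical
  rw [← card_walks]
  refine (Finset.card_le_card ?_).trans (Finset.card_image_le (f := psi M d))
  rintro ⟨a, c, u⟩ hw
  simp only [CfgSet, Finset.mem_filter, Finset.mem_univ, true_and] at hw
  obtain ⟨st, h1, h2, h3, h4⟩ := H a c u hw.eq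
  let l : List Bool := (List.range d).map (fun i : ℕ => a ((i : ℕ) : ZMod d))
  have hlen : l.length = d := by simp [l]
  have hget : ∀ i < d, l.getD i false = a (i : ZMod d) := by
    intro i hi
    simp [l, List.getD, hi]
  have hst : ∀ i ≤ d, (l.take i).foldl M.nx (st 0) = st (i : ZMod d) := by
    intro i
    induction i with
    | zero => intro _; simp
    | succ i ih =>
      intro hi
      rw [foldl_take_succ _ _ _ _ (by omega), ih (by omega), hget i (by omega)]
      push_cast
      exact (h1 _).symm
  rw [Finset.mem_image]
  refine ⟨⟨st 0, l⟩, ?_, ?_⟩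
  · rw [Finset.mem_sigma]
    refine ⟨Finset.mem_univ _, ?_⟩
    simp only
    rw [mem_Lw]
    refine ⟨hlen, ?_, ?_⟩
    · have := hst d le_rfl
      rw [List.take_of_length_le hlen.le, ZMod.natCast_self] at this
      exact this
    · intro i hi
      rw [hst i hi.le, hget i hi, h3]
      refine ⟨h2 _, ?_⟩
      have := (okm_iff p hpd _ _ _).1 (hw.ok (i : ZMod d))
      rwa [ZMod.val_natCast, Nat.mod_eq_of_lt hi] at this
  · simp only [psi, Prod.mk.injEq]
    have hj : ∀ j : ZMod d, (l.take j.val).foldl M.nx (st 0) = st j := by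
      intro j
      rw [hst _ (ZMod.val_lt j).le, ZMod.natCast_zmod_val]
    refine ⟨?_, ?_, ?_⟩
    · funext j; rw [hget _ (ZMod.val_lt j), ZMod.natCast_zmod_val]
    · funext j; rw [hj, h4]
    · funext j; rw [hj, h3]

/-! ## The three automata -/

abbrev S3 := Bool × Bool × Bool
abbrev S6 := Bool × Bool × Bool × Bool × Bool × Bool

/-- carry of three digits -/
def maj (a b c : Bool) : Bool := (a && b) || (c && (a ^^ b))

/-- Segre: registers `(a1, a2, c1)` -/
def autS : Aut S3 where
  nx := fun s x => (x, s.1, maj s.1 s.2.1 s.2.2)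
  uu := fun s => s.1 ^^ s.2.1 ^^ s.2.2
  cr := fun s => maj s.1 s.2.1 s.2.2
  ok := fun _ => true

/-- Glynn I: registers `(a1, a2, c1, c2, c3, c4)` -/
def autI : Aut S6 where
  nx := fun s x => (x, s.1, maj s.1 s.2.1 s.2.2.2.2.2, s.2.2.1, s.2.2.2.1, s.2.2.2.2.1)
  uu := fun s => s.1 ^^ s.2.1 ^^ s.2.2.2.2.2
  cr := fun s => maj s.1 s.2.1 s.2.2.2.2.2
  ok := fun _ => true

/-- at least two of four digits -/
def two4 (a b c e : Bool) : Bool := maj a b c || (e && (a ^^ b ^^ c))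

/-- Glynn II: registers `(a1, a2, a3, a4, c1, c2)` -/
def autII : Aut S6 where
  nx := fun s x => (x, s.1, s.2.1, s.2.2.1,
    two4 s.1 s.2.2.1 s.2.2.2.1 s.2.2.2.2.2, s.2.2.2.2.1)
  uu := fun s => s.1 ^^ s.2.2.1 ^^ s.2.2.2.1 ^^ s.2.2.2.2.2
  cr := fun s => two4 s.1 s.2.2.1 s.2.2.2.1 s.2.2.2.2.2
  ok := fun s => !(s.1 && s.2.2.1 && s.2.2.2.1 && s.2.2.2.2.2)

lemma maj_eq (a b c : Bool) : bt a + bt b + bt c = bt (a ^^ b ^^ c) + 2 * bt (maj a b c) := by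
  cases a <;> cases b <;> cases c <;> simp [bt, maj]

lemma maj_eq' (a b c u k : Bool) (h : bt a + bt b + bt c = bt u + 2 * bt k) :
    (a ^^ b ^^ c) = u ∧ maj a b c = k := by
  revert h
  cases a <;> cases b <;> cases c <;> cases u <;> cases k <;> simp [bt, maj]

lemma two4_eq (a b c e : Bool) (h : (!(a && b && c && e)) = true) :
    bt a + bt b + bt c + bt e = bt (a ^^ b ^^ c ^^ e) + 2 * bt (two4 a b c e) := by
  revert h
  cases a <;> cases b <;> cases c <;> cases e <;> simp [bt, maj, two4]

lemma autI_reg {d : ℕ} (st : ZMod d → S6) (a : ZMod d → Bool)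
    (h : ∀ j, st (j + 1) = autI.nx (st j) (a j)) (j : ZMod d) :
    st j = (a (j - 1), a (j - 2), autI.cr (st (j - 1)), autI.cr (st (j - 2)),
      autI.cr (st (j - 3)), autI.cr (st (j - 4))) := by
  have hp : ∀ j, st j = autI.nx (st (j - 1)) (a (j - 1)) := by
    intro j; have := h (j - 1); rwa [sub_add_cancel] at this
  have e2 : j - 1 - 1 = j - 2 := by ring
  have e3 : j - 2 - 1 = j - 3 := by ring
  have e4 : j - 3 - 1 = j - 4 := by ring
  have h1 := hp j
  have h2 := hp (j - 1)
  have h3 := hp (j - 2)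
  have h4 := hp (j - 3)
  rw [e2] at h2
  rw [e3] at h3
  rw [e4] at h4
  simp only [autI] at h1 h2 h3 h4 ⊢
  ext <;> simp [h1, h2, h3, h4]

lemma autII_reg {d : ℕ} (st : ZMod d → S6) (a : ZMod d → Bool)
    (h : ∀ j, st (j + 1) = autII.nx (st j) (a j)) (j : ZMod d) :
    st j = (a (j - 1), a (j - 2), a (j - 3), a (j - 4), autII.cr (st (j - 1)),
      autII.cr (st (j - 2))) := by
  have hp : ∀ j, st j = autII.nx (st (j - 1)) (a (j - 1)) := by
    intro j; have := h (j - 1); rwa [sub_add_cancel] at this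
  have e2 : j - 1 - 1 = j - 2 := by ring
  have e3 : j - 2 - 1 = j - 3 := by ring
  have e4 : j - 3 - 1 = j - 4 := by ring
  have h1 := hp j
  have h2 := hp (j - 1)
  have h3 := hp (j - 2)
  have h4 := hp (j - 3)
  rw [e2] at h2
  rw [e3] at h3
  rw [e4] at h4
  simp only [autII] at h1 h2 h3 h4 ⊢
  ext <;> simp [h1, h2, h3, h4]

theorem lowerI (d : ℕ) [NeZero d] (hd : 5 ≤ d) : FF autI 4 d ≤ (CfgSet d {1, 2} 4).card := by
  apply walks_le autI d {1, 2} 4 hd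
  · intro st a h _ j
    have hj := autI_reg st a h j
    have h1 : (st j).1 = a (j - 1) := by rw [hj]
    have h2 : (st j).2.1 = a (j - 2) := by rw [hj]
    have h3 : (st j).2.2.2.2.2 = autI.cr (st (j - 4)) := by rw [hj]
    have := maj_eq (st j).1 (st j).2.1 (st j).2.2.2.2.2
    rw [Finset.sum_pair (by norm_num)]
    push_cast
    rw [← h1, ← h2, ← h3]
    exact this
  · intro st st' a h h' hc
    rw [autI_reg st a h 0, autI_reg st' a h' 0]
    simp only [hc]

theorem lowerII (d : ℕ) [NeZero d] (hd : 5 ≤ d) :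
    FF autII 2 d ≤ (CfgSet d {1, 3, 4} 2).card := by
  apply walks_le autII d {1, 3, 4} 2 (by omega)
  · intro st a h hok j
    have hj := autII_reg st a h j
    have h1 : (st j).1 = a (j - 1) := by rw [hj]
    have h2 : (st j).2.2.1 = a (j - 3) := by rw [hj]
    have h3 : (st j).2.2.2.1 = a (j - 4) := by rw [hj]
    have h4 : (st j).2.2.2.2.2 = autII.cr (st (j - 2)) := by rw [hj]
    have := two4_eq (st j).1 (st j).2.2.1 (st j).2.2.2.1 (st j).2.2.2.2.2 (hok j)
    rw [Finset.sum_insert (by norm_num), Finset.sum_pair (by norm_num)]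
    push_cast
    rw [← h1, ← h2, ← h3, ← h4, ← add_assoc]
    exact this
  · intro st st' a h h' hc
    rw [autII_reg st a h 0, autII_reg st' a h' 0]
    simp only [hc]

theorem upperI (d : ℕ) [NeZero d] (hd : 5 ≤ d) : (CfgSet d {1, 2} 4).card ≤ FF autI 4 d := by
  apply le_walks autI d {1, 2} 4 hd
  intro a c u h
  have key : ∀ j, (a (j - 1) ^^ a (j - 2) ^^ c (j - 4)) = u j ∧
      maj (a (j - 1)) (a (j - 2)) (c (j - 4)) = c j := by
    intro j
    have := h j
    rw [Finset.sum_pair (by norm_num)] at this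
    push_cast at this
    exact maj_eq' _ _ _ _ _ this
  refine ⟨fun j => (a (j - 1), a (j - 2), c (j - 1), c (j - 2), c (j - 3), c (j - 4)),
    ?_, fun _ => rfl, fun j => (key j).1, fun j => (key j).2⟩
  intro j
  have e1 : j + 1 - 1 = j := by ring
  have e2 : j + 1 - 2 = j - 1 := by ring
  have e3 : j + 1 - 3 = j - 2 := by ring
  have e4 : j + 1 - 4 = j - 3 := by ring
  simp only [e1, e2, e3, e4, autI, (key j).2]

theorem upperS (d : ℕ) [NeZero d] (hd : 5 ≤ d) : (CfgSet d {1, 2} 1).card ≤ FF autS 1 d := by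
  apply le_walks autS d {1, 2} 1 (by omega)
  intro a c u h
  have key : ∀ j, (a (j - 1) ^^ a (j - 2) ^^ c (j - 1)) = u j ∧
      maj (a (j - 1)) (a (j - 2)) (c (j - 1)) = c j := by
    intro j
    have := h j
    rw [Finset.sum_pair (by norm_num)] at this
    push_cast at this
    exact maj_eq' _ _ _ _ _ this
  refine ⟨fun j => (a (j - 1), a (j - 2), c (j - 1)),
    ?_, fun _ => rfl, fun j => (key j).1, fun j => (key j).2⟩
  intro j
  have e1 : j + 1 - 1 = j := by ring
  have e2 : j + 1 - 2 = j - 1 := by ring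
  simp only [e1, e2, autS, (key j).2]

lemma two_pow_mod (d : ℕ) (a b : ℕ) (h : ∃ q, a = b + q * d) :
    (2 : ℤ) ^ a ≡ 2 ^ b [ZMOD (2 ^ d - 1)] := by
  obtain ⟨q, rfl⟩ := h
  have h1 : (2 : ℤ) ^ d ≡ 1 [ZMOD (2 ^ d - 1)] := (Int.modEq_sub _ _)
  have h2 := (h1.pow q).mul_left (2 ^ b)
  rw [one_pow, mul_one, ← pow_mul, ← pow_add, mul_comm d q] at h2
  exact h2

lemma cast_one_of {d : ℕ} (n : ℕ) (h : ∃ q, n = 1 + q * d) : (n : ZMod d) = 1 := by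
  obtain ⟨q, rfl⟩ := h
  push_cast
  simp

theorem BS_le (d : ℕ) (hd : 5 ≤ d) : B 6 d ≤ d * FF autS 1 d := by
  have : NeZero d := ⟨by omega⟩
  refine (B_le (by omega) {1, 2} (by norm_num) 1 1 6 (by norm_num) (by simp) ?_).trans
    (Nat.mul_le_mul_left d (upperS d hd))
  rw [Finset.sum_pair (by norm_num)]
  norm_num

/-- the multiplier of Glynn I -/
def mI (d : ℕ) : ℕ := if d % 4 = 1 then (3 * d + 1) / 4 else (d + 1) / 4

lemma mI_spec (d : ℕ) (hodd : Odd d) :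
    ((4 : ℕ) : ZMod d) * (mI d : ZMod d) = 1 ∧
    ((2 ^ ((d + 1) / 2) + gam d : ℕ) : ℤ) ≡ ∑ e ∈ ({1, 2} : Finset ℕ), 2 ^ (mI d * e)
      [ZMOD (2 ^ d - 1)] := by
  obtain ⟨k, hk⟩ := hodd
  have h : gam d = 2 ^ mI d := by unfold gam mI; split_ifs <;> rfl
  constructor
  · rw [← Nat.cast_mul]
    apply cast_one_of
    unfold mI
    split_ifs with h4
    · exact ⟨3, by omega⟩
    · exact ⟨1, by omega⟩
  · rw [h, Finset.sum_pair (by norm_num), mul_one]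
    push_cast
    rw [add_comm]
    apply Int.ModEq.add_left
    symm
    apply two_pow_mod
    unfold mI
    split_ifs with h4
    · exact ⟨1, by omega⟩
    · exact ⟨0, by omega⟩

theorem BI_eq (d : ℕ) (hodd : Odd d) (hd : 5 ≤ d) :
    B (2 ^ ((d + 1) / 2) + gam d) d = d * FF autI 4 d := by
  have : NeZero d := ⟨by omega⟩
  obtain ⟨h1, h2⟩ := mI_spec d hodd
  have h3 : 1 ≤ 2 ^ ((d + 1) / 2) + gam d := (Nat.one_le_two_pow).trans (Nat.le_add_right _ _)
  apply le_antisymm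
  · exact (B_le (by omega) {1, 2} (by norm_num) 4 (mI d) _ h3 h1 h2).trans
      (Nat.mul_le_mul_left d (upperI d hd))
  · exact (Nat.mul_le_mul_left d (lowerI d hd)).trans
      (B_ge (by omega) {1, 2} 4 (mI d) _ h3 h1 h2)

theorem BII_ge (d : ℕ) (hodd : Odd d) (hd : 5 ≤ d) :
    d * FF autII 2 d ≤ B (3 * 2 ^ ((d + 1) / 2) + 4) d := by
  have : NeZero d := ⟨by omega⟩
  obtain ⟨k, hk⟩ := hodd
  refine (Nat.mul_le_mul_left d (lowerII d hd)).trans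
    (B_ge (by omega) {1, 3, 4} 2 ((d + 1) / 2) _ (by omega) ?_ ?_)
  · rw [← Nat.cast_mul]
    exact cast_one_of _ ⟨1, by omega⟩
  · rw [Finset.sum_insert (by norm_num), Finset.sum_pair (by norm_num), mul_one]
    have e3 := two_pow_mod d ((d + 1) / 2 * 3) ((d + 1) / 2 + 1) ⟨1, by omega⟩
    have e4 := two_pow_mod d ((d + 1) / 2 * 4) 2 ⟨2, by omega⟩
    have e5 := (e3.add e4).add_left (2 ^ ((d + 1) / 2))
    refine Int.ModEq.trans ?_ e5.symm
    push_cast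
    rw [pow_succ]
    have : (3 * 2 ^ ((d + 1) / 2) + 4 : ℤ) =
      2 ^ ((d + 1) / 2) + (2 ^ ((d + 1) / 2) * 2 + 4) := by ring
    rw [this]

/-! ## Growth -/

lemma stepM_mono {σ : Type} (M : Aut σ) (m : Md) (v w : σ → ℕ) (h : ∀ s, v s ≤ w s) (s : σ) :
    stepM M m v s ≤ stepM M m w s := by
  unfold stepM
  have h0 := h (M.nx s false)
  have h1 := h (M.nx s true)
  cases M.ok s <;> cases alw m (M.uu s) false <;> cases alw m (M.uu s) true <;>
    simp only [cond_true, cond_false] <;> omega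

lemma stepM_smul {σ : Type} (M : Aut σ) (m : Md) (c : ℕ) (v : σ → ℕ) (s : σ) :
    stepM M m (fun x => c * v x) s = c * stepM M m v s := by
  unfold stepM
  cases M.ok s <;> cases alw m (M.uu s) false <;> cases alw m (M.uu s) true <;>
    simp only [cond_true, cond_false] <;> ring

/-- two normal steps -/
def st2 {σ : Type} (M : Aut σ) (v : σ → ℕ) : σ → ℕ := stepM M Md.nrm (stepM M Md.nrm v)

lemma st2_mono {σ : Type} (M : Aut σ) (v w : σ → ℕ) (h : ∀ s, v s ≤ w s) (s : σ) :
    st2 M v s ≤ st2 M w s := stepM_mono M _ _ _ (stepM_mono M _ _ _ h) s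

lemma st2_smul {σ : Type} (M : Aut σ) (c : ℕ) (v : σ → ℕ) (s : σ) :
    st2 M (fun x => c * v x) s = c * st2 M v s := by
  unfold st2
  rw [← stepM_smul]
  congr 1
  funext x
  rw [stepM_smul]

lemma modeR_nrm (p r : ℕ) (hp : 1 ≤ p) (h : p + 1 < r) : modeR p r = Md.nrm := by
  unfold modeR
  have h1 : Nat.beq r (p + 1) = false := by
    rw [← Bool.not_eq_true, Nat.beq_eq]; omega
  have h2 : Nat.beq r 1 = false := by
    rw [← Bool.not_eq_true, Nat.beq_eq]; omega
  rw [h1, h2]; rfl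

lemma cnt_add_two {σ : Type} [DecidableEq σ] (M : Aut σ) (p : ℕ) (t : σ) (r : ℕ) (hp : 1 ≤ p)
    (h : p + 1 ≤ r) : cnt M p t (r + 2) = st2 M (cnt M p t r) := by
  show stepM M (modeR p (r + 1 + 1)) (stepM M (modeR p (r + 1)) (cnt M p t r)) = _
  rw [modeR_nrm p _ hp (by omega), modeR_nrm p _ hp (by omega)]
  rfl

lemma growth_upper {σ : Type} [DecidableEq σ] (M : Aut σ) (p : ℕ) (t : σ) (r α β : ℕ)
    (hp : 1 ≤ p) (h : p + 1 ≤ r) (hw : ∀ s, β * cnt M p t (r + 2) s ≤ α * cnt M p t r s)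
    (i : ℕ) (s : σ) : β ^ i * cnt M p t (r + 2 * i) s ≤ α ^ i * cnt M p t r s := by
  induction i generalizing s with
  | zero => simp
  | succ i ih =>
    have e : r + 2 * (i + 1) = r + 2 * i + 2 := by ring
    rw [e, cnt_add_two M p t _ hp (by omega)]
    calc β ^ (i + 1) * st2 M (cnt M p t (r + 2 * i)) s
        = β * st2 M (fun x => β ^ i * cnt M p t (r + 2 * i) x) s := by rw [st2_smul]; ring
      _ ≤ β * st2 M (fun x => α ^ i * cnt M p t r x) s :=
          Nat.mul_le_mul_left _ (st2_mono M _ _ ih s)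
      _ = α ^ i * (β * cnt M p t (r + 2) s) := by
          rw [st2_smul, cnt_add_two M p t _ hp h]; ring
      _ ≤ α ^ i * (α * cnt M p t r s) := Nat.mul_le_mul_left _ (hw s)
      _ = α ^ (i + 1) * cnt M p t r s := by ring

lemma growth_lower {σ : Type} [DecidableEq σ] (M : Aut σ) (p : ℕ) (t : σ) (r α β : ℕ)
    (hp : 1 ≤ p) (h : p + 1 ≤ r) (w : σ → ℕ) (h0 : ∀ s, w s ≤ cnt M p t r s)
    (hw : ∀ s, α * w s ≤ β * st2 M w s)
    (i : ℕ) (s : σ) : α ^ i * w s ≤ β ^ i * cnt M p t (r + 2 * i) s := by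
  induction i generalizing s with
  | zero => simpa using h0 s
  | succ i ih =>
    have e : r + 2 * (i + 1) = r + 2 * i + 2 := by ring
    rw [e, cnt_add_two M p t _ hp (by omega)]
    calc α ^ (i + 1) * w s = α ^ i * (α * w s) := by ring
      _ ≤ α ^ i * (β * st2 M w s) := Nat.mul_le_mul_left _ (hw s)
      _ = β * st2 M (fun x => α ^ i * w x) s := by rw [st2_smul]; ring
      _ ≤ β * st2 M (fun x => β ^ i * cnt M p t (r + 2 * i) x) s :=
          Nat.mul_le_mul_left _ (st2_mono M _ _ ih s)
      _ = β ^ (i + 1) * st2 M (cnt M p t (r + 2 * i)) s := by rw [st2_smul]; ring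

lemma FF_upper {σ : Type} [DecidableEq σ] [Fintype σ] (M : Aut σ) (p r α β : ℕ)
    (hp : 1 ≤ p) (h : p + 1 ≤ r) (hw : ∀ t s, β * cnt M p t (r + 2) s ≤ α * cnt M p t r s)
    (i : ℕ) : β ^ i * FF M p (r + 2 * i) ≤ α ^ i * FF M p r := by
  unfold FF
  rw [Finset.mul_sum, Finset.mul_sum]
  exact Finset.sum_le_sum fun t _ => growth_upper M p t r α β hp h (hw t) i t

lemma FF_lower {σ : Type} [DecidableEq σ] [Fintype σ] (M : Aut σ) (p r α β : ℕ)
    (hp : 1 ≤ p) (h : p + 1 ≤ r) (w : σ → σ → ℕ) (h0 : ∀ t s, w t s ≤ cnt M p t r s)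
    (hw : ∀ t s, α * w t s ≤ β * st2 M (w t) s)
    (i : ℕ) : α ^ i * ∑ t, w t t ≤ β ^ i * FF M p (r + 2 * i) := by
  unfold FF
  rw [Finset.mul_sum, Finset.mul_sum]
  exact Finset.sum_le_sum fun t _ => growth_lower M p t r α β hp h (w t) (h0 t) (hw t) i t

/-! ## Tables -/

def mkP {α : Type} (f : Bool → α) : α × α := (f false, f true)
def gtP {α : Type} (p : α × α) (b : Bool) : α := cond b p.2 p.1

lemma gtP_mkP {α : Type} (f : Bool → α) (b : Bool) : gtP (mkP f) b = f b := by
  cases b <;> rfl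

def sumB (f : Bool → ℕ) : ℕ := f false + f true
def allB (f : Bool → Bool) : Bool := f false && f true

lemma allB_iff (f : Bool → Bool) : allB f = true ↔ ∀ b, f b = true := by
  simp [allB]

abbrev P2 (α : Type) := α × α

def memo3 (f : S3 → ℕ) : S3 → ℕ :=
  let T : P2 (P2 (P2 ℕ)) := mkP fun a => mkP fun b => mkP fun c => f (a, b, c)
  fun s => gtP (gtP (gtP T s.1) s.2.1) s.2.2

def memo6 (f : S6 → ℕ) : S6 → ℕ :=
  let T : P2 (P2 (P2 (P2 (P2 (P2 ℕ))))) := mkP fun a => mkP fun b => mkP fun c =>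
    mkP fun e => mkP fun g => mkP fun h => f (a, b, c, e, g, h)
  fun s => gtP (gtP (gtP (gtP (gtP (gtP T s.1) s.2.1) s.2.2.1) s.2.2.2.1) s.2.2.2.2.1)
    s.2.2.2.2.2

lemma memo3_eq (f : S3 → ℕ) : memo3 f = f := by
  funext s
  simp only [memo3, gtP_mkP]

lemma memo6_eq (f : S6 → ℕ) : memo6 f = f := by
  funext s
  simp only [memo6, gtP_mkP]

def sum3 (f : S3 → ℕ) : ℕ := sumB fun a => sumB fun b => sumB fun c => f (a, b, c)
def sum6 (f : S6 → ℕ) : ℕ := sumB fun a => sumB fun b => sumB fun c =>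
    sumB fun e => sumB fun g => sumB fun h => f (a, b, c, e, g, h)

lemma sumB_eq (f : Bool → ℕ) : ∑ b, f b = sumB f := by
  rw [Fintype.sum_bool, add_comm]; rfl

lemma sum3_eq (f : S3 → ℕ) : ∑ s, f s = sum3 f := by
  simp only [Fintype.sum_prod_type, sumB_eq, sum3]

lemma sum6_eq (f : S6 → ℕ) : ∑ s, f s = sum6 f := by
  simp only [Fintype.sum_prod_type, sumB_eq, sum6]

def all3 (f : S3 → Bool) : Bool := allB fun a => allB fun b => allB fun c => f (a, b, c)
def all6 (f : S6 → Bool) : Bool := allB fun a => allB fun b => allB fun c =>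
    allB fun e => allB fun g => allB fun h => f (a, b, c, e, g, h)

lemma all3_iff (f : S3 → Bool) : all3 f = true ↔ ∀ s, f s = true := by
  simp only [all3, allB_iff, Prod.forall]

lemma all6_iff (f : S6 → Bool) : all6 f = true ↔ ∀ s, f s = true := by
  simp only [all6, allB_iff, Prod.forall]

def eqB (a b : Bool) : Bool := cond a b (!b)

lemma eqB_iff (a b : Bool) : eqB a b = true ↔ a = b := by cases a <;> cases b <;> decide

def eq3 (s t : S3) : Bool := eqB s.1 t.1 && (eqB s.2.1 t.2.1 && eqB s.2.2 t.2.2)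
def eq6 (s t : S6) : Bool := eqB s.1 t.1 && (eqB s.2.1 t.2.1 && (eqB s.2.2.1 t.2.2.1 &&
  (eqB s.2.2.2.1 t.2.2.2.1 && (eqB s.2.2.2.2.1 t.2.2.2.2.1 && eqB s.2.2.2.2.2 t.2.2.2.2.2))))

lemma eq3_iff (s t : S3) : eq3 s t = true ↔ s = t := by
  simp only [eq3, Bool.and_eq_true, eqB_iff, Prod.ext_iff]

lemma eq6_iff (s t : S6) : eq6 s t = true ↔ s = t := by
  simp only [eq6, Bool.and_eq_true, eqB_iff, Prod.ext_iff]

/-- memoized iteration -/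
def itM {σ : Type} (M : Aut σ) (p : ℕ) (mem : (σ → ℕ) → σ → ℕ) (eqs : σ → σ → Bool) (t : σ)
    (n : ℕ) : σ → ℕ :=
  Nat.rec (fun s => bif eqs s t then 1 else 0)
    (fun r v => mem (stepM M (modeR p (Nat.succ r)) v)) n

lemma itM_eq {σ : Type} [DecidableEq σ] (M : Aut σ) (p : ℕ) (mem : (σ → ℕ) → σ → ℕ)
    (eqs : σ → σ → Bool) (hm : ∀ f, mem f = f) (he : ∀ s t, eqs s t = true ↔ s = t) (t : σ)
    (n : ℕ) : itM M p mem eqs t n = cnt M p t n := by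
  induction n with
  | zero =>
    funext s
    show (bif eqs s t then 1 else 0) = if s = t then 1 else 0
    by_cases h : s = t
    · rw [if_pos h, (he s t).2 h]; rfl
    · have : eqs s t = false := by rw [← Bool.not_eq_true, he]; exact h
      rw [if_neg h, this]; rfl
  | succ n ih =>
    show mem (stepM M (modeR p (n + 1)) (itM M p mem eqs t n)) = _
    rw [hm, ih]
    rfl

/-! ## Computations -/

def iS (t : S3) (n : ℕ) : S3 → ℕ := itM autS 1 memo3 eq3 t n
def iI (t : S6) (n : ℕ) : S6 → ℕ := itM autI 4 memo6 eq6 t n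
def iII (t : S6) (n : ℕ) : S6 → ℕ := itM autII 2 memo6 eq6 t n

lemma iS_eq (t : S3) (n : ℕ) : iS t n = cnt autS 1 t n :=
  itM_eq _ _ _ _ memo3_eq eq3_iff t n
lemma iI_eq (t : S6) (n : ℕ) : iI t n = cnt autI 4 t n :=
  itM_eq _ _ _ _ memo6_eq eq6_iff t n
lemma iII_eq (t : S6) (n : ℕ) : iII t n = cnt autII 2 t n :=
  itM_eq _ _ _ _ memo6_eq eq6_iff t n

/-- end states which can contribute for Glynn I -/
def actI (t : S6) : Bool := !t.1 && cond t.2.1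
  (cond t.2.2.1 (eqB t.2.2.2.1 t.2.2.2.2.1) (!t.2.2.2.1)) (!t.2.2.1)

/-- end states used for Glynn II -/
def actII (t : S6) : Bool :=
  !t.1 && (t.2.2.1 && (eqB t.2.2.2.1 t.2.2.2.2.1 && (t.2.1 ^^ t.2.2.2.2.2)))

def fS (n : ℕ) : ℕ := sum3 fun t => iS t n t
def fI (n : ℕ) : ℕ := sum6 fun t => bif actI t then iI t n t else 0
def fII (n : ℕ) : ℕ := sum6 fun t => bif actII t then iII t n t else 0

set_option maxRecDepth 100000
set_option maxHeartbeats 0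

theorem comp0 : (all6 fun t => cond (actI t) true (all6 fun s => Nat.beq (iI t 5 s) 0)) = true := by
  decide +kernel

lemma cntI_zero (t : S6) (h : actI t = false) (n : ℕ) (hn : 5 ≤ n) (s : S6) :
    cnt autI 4 t n s = 0 := by
  induction n, hn using Nat.le_induction generalizing s with
  | base =>
    have h0 := comp0
    rw [all6_iff] at h0
    have h1 := h0 t
    rw [h] at h1
    simp only [cond_false, all6_iff, Nat.beq_eq] at h1
    rw [← iI_eq]
    exact h1 s
  | succ n hn ih =>
    simp only [cnt, stepM, ih]
    simp

lemma fS_eq (n : ℕ) : FF autS 1 n = fS n := by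
  simp only [FF, sum3_eq, fS, iS_eq]

lemma fI_eq (n : ℕ) (hn : 5 ≤ n) : FF autI 4 n = fI n := by
  simp only [fI, ← sum6_eq, iI_eq, FF]
  apply Finset.sum_congr rfl
  intro t _
  cases h : actI t
  · simp [cntI_zero t h n hn]
  · simp

lemma fII_le (n : ℕ) : fII n ≤ FF autII 2 n := by
  simp only [fII, ← sum6_eq, iII_eq, FF]
  apply Finset.sum_le_sum
  intro t _
  cases actII t <;> simp

/-- states kept in the lower bound for Glynn I -/
def keepI (s : S6) : Bool :=
  !(eq6 s (false, false, false, false, false, false) ||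
    eq6 s (true, false, false, true, false, true) ||
    eq6 s (true, false, true, false, false, false) ||
    eq6 s (true, false, true, false, true, false) ||
    eq6 s (false, false, true, false, true, true) ||
    eq6 s (true, false, true, true, true, false) ||
    eq6 s (true, true, false, true, false, false) ||
    eq6 s (true, true, false, true, false, true) ||
    eq6 s (false, true, false, true, true, true) ||
    eq6 s (false, true, true, false, true, false))

/-- states kept in the lower bound for Glynn II -/
def keepII (s : S6) : Bool := !(eq6 s (false, false, false, false, false, false))

def wI (t s : S6) : ℕ := bif keepI s then iI t 33 s else 0
def wII (t s : S6) : ℕ := bif keepII s then iII t 33 s else 0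

/-- two memoized normal steps -/
def sm2 (M : Aut S6) (v : S6 → ℕ) : S6 → ℕ :=
  stepM M Md.nrm (memo6 (stepM M Md.nrm (memo6 v)))

lemma sm2_eq (M : Aut S6) (v : S6 → ℕ) : sm2 M v = st2 M v := by
  simp only [sm2, memo6_eq, st2]

theorem compS : (Nat.beq (fS 15) 41 && (Nat.beq (fS 17) 67 && (Nat.beq (fS 19) 109 &&
    (Nat.beq (fS 21) 177 && (Nat.beq (fS 23) 287 && (Nat.beq (fS 25) 465 &&
    (Nat.beq (fS 27) 753 && (Nat.beq (fS 29) 1219 && (Nat.beq (fS 31) 1973 &&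
    (Nat.beq (fS 33) 3193 && all3 fun t => all3 fun s =>
      Nat.ble (4 * iS t 35 s) (7 * iS t 33 s))))))))))) = true := by decide +kernel

theorem compI : (Nat.beq (fI 15) 45 && (Nat.beq (fI 17) 87 && (Nat.beq (fI 19) 167 &&
    (Nat.beq (fI 21) 321 && (Nat.beq (fI 23) 619 && (Nat.beq (fI 25) 1193 &&
    (Nat.beq (fI 27) 2299 && (Nat.beq (fI 29) 4431 && (Nat.beq (fI 31) 8541 &&
    (Nat.beq (fI 33) 16463 && (Nat.beq (sum6 fun t => bif actI t then wI t t else 0) 16462 &&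
    all6 fun t => cond (actI t) (all6 fun s =>
      Nat.ble (iI t 35 s) (2 * iI t 33 s) &&
      Nat.ble (7 * wI t s) (4 * sm2 autI (wI t) s)) true))))))))))) = true := by decide +kernel

theorem compII : (Nat.beq (fII 15) 89 && (Nat.beq (fII 17) 173 && (Nat.beq (fII 19) 383 &&
    (Nat.beq (fII 21) 777 && (Nat.beq (fII 23) 1665 && (Nat.beq (fII 25) 3441 &&
    (Nat.beq (fII 27) 7277 && (Nat.beq (fII 29) 15159 && (Nat.beq (fII 31) 31885 &&
    (Nat.beq (fII 33) 66645 && (Nat.beq (sum6 fun t => bif actII t then wII t t else 0) 66645 &&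
    all6 fun t => cond (actII t) (all6 fun s =>
      Nat.ble (2 * wII t s) (sm2 autII (wII t) s)) true))))))))))) = true := by decide +kernel

theorem growS (i : ℕ) : 4 ^ i * FF autS 1 (33 + 2 * i) ≤ 7 ^ i * 3193 := by
  have h := compS
  simp only [Bool.and_eq_true, Nat.beq_eq, all3_iff, Nat.ble_eq] at h
  obtain ⟨-, -, -, -, -, -, -, -, -, h0, h1⟩ := h
  rw [← fS_eq] at h0
  rw [← h0]
  apply FF_upper autS 1 33 7 4 (by norm_num) (by norm_num)
  intro t s
  have := h1 t s
  rwa [iS_eq, iS_eq] at this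

theorem growI_upper (i : ℕ) : FF autI 4 (33 + 2 * i) ≤ 2 ^ i * 16463 := by
  have h := compI
  simp only [Bool.and_eq_true, Nat.beq_eq, all6_iff] at h
  obtain ⟨-, -, -, -, -, -, -, -, -, h0, -, h1⟩ := h
  rw [← fI_eq _ (by norm_num)] at h0
  rw [← h0]
  have := FF_upper autI 4 33 2 1 (by norm_num) (by norm_num) (fun t s => by
    have h2 := h1 t
    rw [one_mul]
    cases h : actI t
    · rw [cntI_zero t h _ (by norm_num)]
      exact Nat.zero_le _
    · rw [h] at h2
      simp only [cond_true, Bool.and_eq_true, all6_iff, Nat.ble_eq] at h2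
      have := (h2 s).1
      rw [iI_eq, iI_eq] at this
      exact this) i
  rwa [one_pow, one_mul] at this

theorem growI_lower (i : ℕ) : 7 ^ i * 16462 ≤ 4 ^ i * FF autI 4 (33 + 2 * i) := by
  have h := compI
  simp only [Bool.and_eq_true, Nat.beq_eq, all6_iff] at h
  obtain ⟨-, -, -, -, -, -, -, -, -, -, h0, h1⟩ := h
  rw [← sum6_eq] at h0
  rw [← h0]
  refine FF_lower autI 4 33 7 4 (by norm_num) (by norm_num)
    (fun t s => bif actI t then wI t s else 0) ?_ ?_ i
  · intro t s
    unfold wI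
    rw [iI_eq]
    cases actI t
    · exact Nat.zero_le _
    · cases keepI s
      · exact Nat.zero_le _
      · exact le_rfl
  · intro t s
    have h2 := h1 t
    cases h : actI t
    · simp
    · rw [h] at h2
      simp only [cond_true, Bool.and_eq_true, all6_iff, Nat.ble_eq] at h2
      have := (h2 s).2
      rw [sm2_eq] at this
      exact this

theorem growII_lower (i : ℕ) : 2 ^ i * 66645 ≤ FF autII 2 (33 + 2 * i) := by
  have h := compII
  simp only [Bool.and_eq_true, Nat.beq_eq, all6_iff] at h
  obtain ⟨-, -, -, -, -, -, -, -, -, -, h0, h1⟩ := h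
  rw [← sum6_eq] at h0
  rw [← h0]
  have := FF_lower autII 2 33 2 1 (by norm_num) (by norm_num)
    (fun t s => bif actII t then wII t s else 0) (fun t s => by
    unfold wII
    rw [iII_eq]
    cases actII t
    · exact Nat.zero_le _
    · cases keepII s
      · exact Nat.zero_le _
      · exact le_rfl) (fun t s => by
    have h2 := h1 t
    cases h : actII t
    · simp
    · rw [h] at h2
      simp only [cond_true, all6_iff, Nat.ble_eq] at h2
      have := h2 s
      rw [sm2_eq] at this
      rw [one_mul]
      exact this) i
  rwa [one_pow, one_mul] at this

theorem FF_compare (d : ℕ) (hodd : Odd d) (hd : 15 ≤ d) :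
    FF autI 4 d < FF autII 2 d ∧ FF autS 1 d < FF autI 4 d := by
  rcases Nat.lt_or_ge d 33 with h | h
  · have hS := compS
    have hI := compI
    have hII := compII
    simp only [Bool.and_eq_true, Nat.beq_eq, ← fS_eq] at hS hI hII
    obtain ⟨a1, a2, a3, a4, a5, a6, a7, a8, a9, -⟩ := hS
    obtain ⟨b1, b2, b3, b4, b5, b6, b7, b8, b9, -⟩ := hI
    obtain ⟨c1, c2, c3, c4, c5, c6, c7, c8, c9, -⟩ := hII
    obtain ⟨k, hk⟩ := hodd
    have h1 : 7 ≤ k := by omega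
    have h2 : k ≤ 15 := by omega
    subst hk
    clear hd h
    interval_cases k
    · have := fII_le 15
      have := fI_eq 15 (by norm_num)
      norm_num
      omega
    · have := fII_le 17
      have := fI_eq 17 (by norm_num)
      norm_num
      omega
    · have := fII_le 19
      have := fI_eq 19 (by norm_num)
      norm_num
      omega
    · have := fII_le 21
      have := fI_eq 21 (by norm_num)
      norm_num
      omega
    · have := fII_le 23
      have := fI_eq 23 (by norm_num)
      norm_num
      omega
    · have := fII_le 25
      have := fI_eq 25 (by norm_num)
      norm_num
      omega
    · have := fII_le 27
      have := fI_eq 27 (by norm_num)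
      norm_num
      omega
    · have := fII_le 29
      have := fI_eq 29 (by norm_num)
      norm_num
      omega
    · have := fII_le 31
      have := fI_eq 31 (by norm_num)
      norm_num
      omega
  · obtain ⟨k, hk⟩ := hodd
    obtain ⟨i, rfl⟩ : ∃ i, d = 33 + 2 * i := ⟨k - 16, by omega⟩
    have h1 := growS i
    have h2 := growI_upper i
    have h3 := growI_lower i
    have h4 := growII_lower i
    have p2 : 0 < 2 ^ i := by positivity
    have p7 : 0 < 7 ^ i := by positivity
    constructor
    · omega
    · apply lt_of_mul_lt_mul_left (a := 4 ^ i) _ (Nat.zero_le _)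
      omega

/-- For odd `d ≥ 15`, `B_{3σ+4}(d) > B_{σ+γ}(d) > B_6(d)`, where `σ = 2^{(d+1)/2}`. -/
theorem stmt_12 (d : ℕ) (hodd : Odd d) (hd : 15 ≤ d) :
    B (3 * 2 ^ ((d + 1) / 2) + 4) d > B (2 ^ ((d + 1) / 2) + gam d) d ∧
    B (2 ^ ((d + 1) / 2) + gam d) d > B 6 d := by
  obtain ⟨h1, h2⟩ := FF_compare d hodd hd
  have hS := BS_le d (by omega)
  have hI := BI_eq d hodd (by omega)
  have hII := BII_ge d hodd (by omega)
  have k1 := Nat.mul_lt_mul_of_pos_left h1 (show 0 < d by omega)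
  have k2 := Nat.mul_lt_mul_of_pos_left h2 (show 0 < d by omega)
  rw [hI]
  exact ⟨lt_of_lt_of_le k1 hII, lt_of_le_of_lt hS k2⟩
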